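/- Let R^12 be the profile ≽_1: c,{a,b},d; ≽_2: b,{a,c},d; ≽_3: a,d,{b,c}; ≽_4: {b,c},a,d. Then f(R^12) = 1/2 b + 1/2 c. -/

import Mathlib

open Finset
open scoped Classical

section Framework

variable {A : Type*} [Fintype A] {n : ℕ}

/-- `p` is a lottery (probability distribution) on the set of alternatives `A`. -/
def IsLottery (p : A → ℝ) : Prop := (∀ x, 0 ≤ p x) ∧ ∑ x, p x = 1

/-- `r` is a weak preference relation: complete (total) and transitive. -/
def IsPref (r : A → A → Prop) : Prop := Total r ∧ Transitive r

/-- A preference profile assigns a weak preference relation to each of the `n` agents. -/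
def IsProfile (R : Fin n → A → A → Prop) : Prop := ∀ i, IsPref (R i)

/-- The probability that `p` assigns to alternatives weakly preferred (by `r`) to `x`. -/
noncomputable def upperProb (r : A → A → Prop) (p : A → ℝ) (x : A) : ℝ :=
  ∑ y ∈ univ.filter (fun y => r y x), p y

/-- Stochastic dominance: `p ≽^sd q` w.r.t. the preference relation `r`. -/
def SDge (r : A → A → Prop) (p q : A → ℝ) : Prop :=
  ∀ x, upperProb r q x ≤ upperProb r p x

/-- Strict stochastic dominance: `p ≻^sd q` w.r.t. the preference relation `r`. -/
def SDgt (r : A → A → Prop) (p q : A → ℝ) : Prop :=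
  SDge r p q ∧ ¬ SDge r q p

/-- A social decision scheme maps every preference profile to a lottery. -/
def IsSDS (f : (Fin n → A → A → Prop) → (A → ℝ)) : Prop :=
  ∀ R : Fin n → A → A → Prop, IsProfile R → IsLottery (f R)

/-- Anonymity: invariance under permutations of the agents. -/
def Anonymous (f : (Fin n → A → A → Prop) → (A → ℝ)) : Prop :=
  ∀ R : Fin n → A → A → Prop, IsProfile R → ∀ π : Equiv.Perm (Fin n),
    f (fun i => R (π i)) = f R

/-- Neutrality: `f(R^σ)(σ x) = f(R)(x)`, where `R^σ` relabels alternatives by `σ`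
(i.e. `σ x ≽^σ_i σ y ↔ x ≽_i y`). -/
def Neutral (f : (Fin n → A → A → Prop) → (A → ℝ)) : Prop :=
  ∀ R : Fin n → A → A → Prop, IsProfile R → ∀ σ : Equiv.Perm A, ∀ x : A,
    f (fun i u v => R i (σ.symm u) (σ.symm v)) (σ x) = f R x

/-- The lottery `p` is sd-efficient for the profile `R`: no lottery `q` is weakly
sd-preferred to `p` by all agents and strictly sd-preferred by some agent. -/
def SDEfficientLottery (R : Fin n → A → A → Prop) (p : A → ℝ) : Prop :=
  ¬ ∃ q : A → ℝ, IsLottery q ∧ (∀ i, SDge (R i) q p) ∧ (∃ i, SDgt (R i) q p)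

/-- sd-efficiency of a social decision scheme. -/
def SDEfficient (f : (Fin n → A → A → Prop) → (A → ℝ)) : Prop :=
  ∀ R : Fin n → A → A → Prop, IsProfile R → SDEfficientLottery R (f R)

/-- sd-strategyproofness: no agent can misreport and obtain a strictly
sd-preferred lottery. -/
def SDStrategyproof (f : (Fin n → A → A → Prop) → (A → ℝ)) : Prop :=
  ∀ R R' : Fin n → A → A → Prop, IsProfile R → IsProfile R' → ∀ i : Fin n,
    (∀ j, j ≠ i → R j = R' j) → ¬ SDgt (R i) (f R') (f R)

/-- `x` is the unique most-preferred alternative of the relation `r`. -/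
def UniqueTop (r : A → A → Prop) (x : A) : Prop :=
  ∀ y, y ≠ x → r x y ∧ ¬ r y x

/-- `f` extends random dictatorship: whenever every agent has a unique top choice,
each alternative gets probability (number of agents having it as top)/n. -/
def ExtendsRD (f : (Fin n → A → A → Prop) → (A → ℝ)) : Prop :=
  ∀ R : Fin n → A → A → Prop, IsProfile R →
    ∀ t : Fin n → A, (∀ i, UniqueTop (R i) (t i)) →
      ∀ x : A, f R x = ((univ.filter (fun i => t i = x)).card : ℝ) / (n : ℝ)

/-- `x` is Pareto-dominated in the profile `R`. -/
def Pareto_Dominated (R : Fin n → A → A → Prop) (x : A) : Prop :=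
  ∃ y : A, (∀ i, R i y x) ∧ ∃ i, R i y x ∧ ¬ R i x y

end Framework

/-! Concrete setting: alternatives `A = {a,b,c,d}` encoded as `Fin 4`. -/

/-- The alternative `a`. -/ def a : Fin 4 := 0
/-- The alternative `b`. -/ def b : Fin 4 := 1
/-- The alternative `c`. -/ def c : Fin 4 := 2
/-- The alternative `d`. -/ def d : Fin 4 := 3

/-- The weak preference relation induced by a rank function over `(a,b,c,d)`
(lower rank = more preferred; equal ranks = indifference). -/
def pr (rk : Fin 4 → ℕ) : Fin 4 → Fin 4 → Prop := fun x y => rk x ≤ rk y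


/-- The profile `R12`: ≽₁: c,{a,b},d; ≽₂: b,{a,c},d; ≽₃: a,d,{b,c}; ≽₄: {b,c},a,d. -/
def R12 : Fin 4 → Fin 4 → Fin 4 → Prop :=
  ![pr ![1,1,0,2], pr ![1,0,1,2], pr ![0,2,2,1], pr ![1,0,0,2]]

section Auxiliary

lemma isPref_pr (rk : Fin 4 → ℕ) : IsPref (pr rk) :=
  ⟨fun x y => le_total (rk x) (rk y), fun _ _ _ hxy hyz => le_trans hxy hyz⟩

lemma isProfile_pr (r₁ r₂ r₃ r₄ : Fin 4 → ℕ) :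
    IsProfile ![pr r₁, pr r₂, pr r₃, pr r₄] := by
  intro i
  fin_cases i <;> exact isPref_pr _

lemma upperProb_pr (rk : Fin 4 → ℕ) (p : Fin 4 → ℝ) (x : Fin 4) :
    upperProb (pr rk) p x = ∑ y, if rk y ≤ rk x then p y else 0 := by
  rw [upperProb, sum_filter]
  refine sum_congr rfl fun y _ => ?_
  simp only [pr]
  congr

/-- Moving all mass from a Pareto-dominated alternative to a dominating one improves a lottery. -/
lemma eq_zero_of_paretoDominated {A : Type*} [Fintype A] {n : ℕ}
    {R : Fin n → A → A → Prop} {p : A → ℝ} {x : A} (hR : IsProfile R) (hp : IsLottery p)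
    (heff : SDEfficientLottery R p) (hx : Pareto_Dominated R x) : p x = 0 := by
  by_contra hne
  have hpos : 0 < p x := lt_of_le_of_ne (hp.1 x) (Ne.symm hne)
  obtain ⟨y, hy, i, hiy, hix⟩ := hx
  have hxy : x ≠ y := by
    rintro rfl
    exact hix hiy
  let q : A → ℝ := fun z => p z + ((if z = y then p x else 0) - if z = x then p x else 0)
  have hq (r : A → A → Prop) (z : A) : upperProb r q z =
      upperProb r p z + ((if r y z then p x else 0) - if r x z then p x else 0) := by
    simp [upperProb, q, sum_add_distrib, sum_sub_distrib]
  have hge (j : Fin n) : SDge (R j) q p := by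
    intro z
    have htrans : R j x z → R j y z := fun h => (hR j).2 (hy j) h
    rw [hq]
    by_cases h : R j x z
    · simp [h, htrans h]
    · by_cases h' : R j y z <;> simp [h, h', hpos.le]
  refine heff ⟨q, ⟨fun z => ?_, ?_⟩, hge, i, hge i, fun h => ?_⟩
  · have := hp.1 z
    by_cases hzx : z = x
    · subst hzx
      simp [q, hxy]
    · simp only [q, hzx, if_false]
      split_ifs <;> linarith
  · simpa [q, sum_add_distrib, sum_sub_distrib] using hp.2
  · have hiyy : R i y y := ((hR i).1 y y).elim id id
    have := h y
    rw [hq] at this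
    simp only [hix, hiyy, if_true, if_false] at this
    linarith

/-- A relabelling of the alternatives that only permutes the agents preserves the lottery. -/
lemma apply_eq_of_symmetry {A : Type*} [Fintype A] {n : ℕ}
    {f : (Fin n → A → A → Prop) → (A → ℝ)} (han : Anonymous f) (hneu : Neutral f)
    {R : Fin n → A → A → Prop} (hR : IsProfile R) (σ : Equiv.Perm A) (π : Equiv.Perm (Fin n))
    (h : ∀ i u v, R i (σ.symm u) (σ.symm v) ↔ R (π i) u v) (x : A) :
    f R (σ x) = f R x := by
  have hrel : (fun i u v => R i (σ.symm u) (σ.symm v)) = fun i => R (π i) := by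
    funext i u v
    exact propext (h i u v)
  rw [← hneu R hR σ x, hrel, han R hR π]

variable {f : (Fin 4 → Fin 4 → Fin 4 → Prop) → (Fin 4 → ℝ)}

/-- Lotteries for the profiles in which agents 1 and 2 report `c,{a,b},d` and `b,{a,c},d`, while
the others' preferences are symmetric in `b` and `c` and put `a` weakly above `d`. -/
lemma lottery_of_symmetric_profile (hf : IsSDS f) (han : Anonymous f) (hneu : Neutral f)
    (heff : SDEfficient f) {r s : Fin 4 → ℕ} (hr : r 1 = r 2) (hs : s 1 = s 2)
    (hr' : r 0 ≤ r 3) (hs' : s 0 ≤ s 3) {p : Fin 4 → ℝ}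
    (hp : p = f ![pr ![1,1,0,2], pr ![1,0,1,2], pr r, pr s]) :
    p 0 = 1 - 2 * p 1 ∧ p 2 = p 1 ∧ p 3 = 0 ∧ 0 ≤ p 0 := by
  have hR := isProfile_pr ![1,1,0,2] ![1,0,1,2] r s
  subst hp
  have hlot := hf _ hR
  have hbc := apply_eq_of_symmetry han hneu hR (Equiv.swap 1 2) (Equiv.swap 0 1) (by
    intro i u v
    fin_cases i <;> fin_cases u <;> fin_cases v <;> simp [pr, Equiv.swap_apply_def, hr, hs]) 1
  have hd := eq_zero_of_paretoDominated (x := 3) hR hlot (heff _ hR) ⟨0, by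
    intro i
    fin_cases i <;> simp [pr, hr', hs'], 0, by simp [pr]⟩
  have hsum := hlot.2
  rw [Equiv.swap_apply_left] at hbc
  rw [Fin.sum_univ_four] at hsum
  exact ⟨by linarith, hbc, hd, hlot.1 0⟩

lemma lottery_of_seed_profile (hf : IsSDS f) (han : Anonymous f) (hneu : Neutral f)
    (heff : SDEfficient f) :
    f ![pr ![0,1,0,2], pr ![1,0,2,0], pr ![0,1,1,0], pr ![1,0,0,1]] = ![1/2, 1/2, 0, 0] := by
  have hR := isProfile_pr ![0,1,0,2] ![1,0,2,0] ![0,1,1,0] ![1,0,0,1]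
  have hsymm := apply_eq_of_symmetry han hneu hR (Equiv.swap 0 1 * Equiv.swap 2 3)
    (Equiv.swap 0 1 * Equiv.swap 2 3) (by
      intro i u v
      fin_cases i <;> fin_cases u <;> fin_cases v <;>
        simp [pr, Equiv.swap_apply_def, ← Equiv.Perm.inv_def])
  have hlot := hf _ hR
  have he := heff _ hR
  revert hsymm hlot he
  generalize f _ = p
  intro hsymm hlot he
  have hab : p 1 = p 0 := by simpa [Equiv.swap_apply_def] using hsymm 0
  have hcd : p 3 = p 2 := by simpa [Equiv.swap_apply_def] using hsymm 2
  have hsum := hlot.2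
  rw [Fin.sum_univ_four] at hsum
  have hc : p 2 = 0 := by
    by_contra hne
    have hpos : 0 < p 2 := lt_of_le_of_ne (hlot.1 2) (Ne.symm hne)
    have ha := hlot.1 0
    have hge (i : Fin 4) : SDge
        (![pr ![0,1,0,2], pr ![1,0,2,0], pr ![0,1,1,0], pr ![1,0,0,1]] i) ![1/2, 1/2, 0, 0] p := by
      intro x
      fin_cases i <;> fin_cases x <;> simp [upperProb_pr, Fin.sum_univ_four] <;> linarith
    refine he ⟨![1/2, 1/2, 0, 0], ⟨fun x => ?_, ?_⟩, hge, 0, hge 0, fun h => ?_⟩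
    · fin_cases x <;> simp
    · simp [Fin.sum_univ_four]
      norm_num
    · have := h 1
      simp [upperProb_pr, Fin.sum_univ_four] at this
      linarith
  funext x
  fin_cases x <;> simp <;> linarith

/-- Strategyproofness forbids a beneficial misreport, so a weakly better outcome of a misreport is
also weakly worse. -/
lemma sdGe_of_misreport {n : ℕ} {A : Type*} [Fintype A]
    {f : (Fin n → A → A → Prop) → (A → ℝ)} (hsp : SDStrategyproof f)
    {R R' : Fin n → A → A → Prop} (hR : IsProfile R) (hR' : IsProfile R') (i : Fin n)
    (h : ∀ j, j ≠ i → R j = R' j) (hge : SDge (R i) (f R') (f R)) : SDge (R i) (f R) (f R') :=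
  not_not.mp fun hlt => hsp R R' hR hR' i h ⟨hge, hlt⟩

end Auxiliary

theorem stmt15 (f : (Fin 4 → Fin 4 → Fin 4 → Prop) → (Fin 4 → ℝ))
    (hf : IsSDS f) (han : Anonymous f) (hneu : Neutral f)
    (heff : SDEfficient f) (hsp : SDStrategyproof f) :
    f R12 = ![0, 1/2, 1/2, 0] := by
  have hR₁ := isProfile_pr ![0,1,0,2] ![1,0,2,0] ![0,1,1,0] ![1,0,0,1]
  have hR₂ := isProfile_pr ![0,1,0,2] ![1,0,1,2] ![0,1,1,0] ![1,0,0,1]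
  have hR₃ := isProfile_pr ![1,1,0,2] ![1,0,1,2] ![0,1,1,0] ![1,0,0,1]
  have hR₄ := isProfile_pr ![1,1,0,2] ![1,0,1,2] ![0,2,2,1] ![1,0,0,1]
  have hR₅ := isProfile_pr ![1,1,0,2] ![1,0,1,2] ![0,2,2,1] ![1,0,0,2]
  have h₂₁ := sdGe_of_misreport hsp hR₂ hR₁ 1 (by intro j hj; fin_cases j <;> simp_all)
  have h₂₃ := sdGe_of_misreport hsp hR₂ hR₃ 0 (by intro j hj; fin_cases j <;> simp_all)
  have h₃₄ := sdGe_of_misreport hsp hR₃ hR₄ 2 (by intro j hj; fin_cases j <;> simp_all)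
  have h₅₄ := sdGe_of_misreport hsp hR₅ hR₄ 3 (by intro j hj; fin_cases j <;> simp_all)
  have hlot₂ := hf _ hR₂
  have hd₂ := eq_zero_of_paretoDominated (x := 3) hR₂ hlot₂ (heff _ hR₂) ⟨0, by
    intro i
    fin_cases i <;> simp [pr], 0, by simp [pr]⟩
  rw [lottery_of_seed_profile hf han hneu heff] at h₂₁
  change f ![pr ![1,1,0,2], pr ![1,0,1,2], pr ![0,2,2,1], pr ![1,0,0,2]] = _
  generalize hp₂ : f ![pr ![0,1,0,2], pr ![1,0,1,2], pr ![0,1,1,0], pr ![1,0,0,1]] = p₂ at *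
  generalize hp₃ : f ![pr ![1,1,0,2], pr ![1,0,1,2], pr ![0,1,1,0], pr ![1,0,0,1]] = p₃ at *
  generalize hp₄ : f ![pr ![1,1,0,2], pr ![1,0,1,2], pr ![0,2,2,1], pr ![1,0,0,1]] = p₄ at *
  generalize hp₅ : f ![pr ![1,1,0,2], pr ![1,0,1,2], pr ![0,2,2,1], pr ![1,0,0,2]] = p₅ at *
  obtain ⟨ha₃, hc₃, hd₃, hn₃⟩ := lottery_of_symmetric_profile hf han hneu heff
    (by simp) (by simp) (by simp) (by simp) hp₃.symm
  obtain ⟨ha₄, hc₄, hd₄, hn₄⟩ := lottery_of_symmetric_profile hf han hneu heff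
    (by simp) (by simp) (by simp) (by simp) hp₄.symm
  obtain ⟨ha₅, hc₅, hd₅, hn₅⟩ := lottery_of_symmetric_profile hf han hneu heff
    (by simp) (by simp) (by simp) (by simp) hp₅.symm
  have hsum₂ := hlot₂.2
  have hc₂ := hlot₂.1 2
  rw [Fin.sum_univ_four] at hsum₂
  have hb₂ : 1 / 2 ≤ p₂ 1 := by
    by_contra! hlt
    have := h₂₁ (by
      intro x
      fin_cases x <;> simp [upperProb_pr, Fin.sum_univ_four] <;> linarith) 1
    simp [upperProb_pr, Fin.sum_univ_four] at this
    linarith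
  have hb₃ : p₃ 1 = 1 / 2 := by
    by_contra hne
    have hlt : p₃ 1 < 1 / 2 := lt_of_le_of_ne (by linarith) hne
    have := h₂₃ (by
      intro x
      fin_cases x <;> simp [upperProb_pr, Fin.sum_univ_four] <;> linarith) 0
    simp [upperProb_pr, Fin.sum_univ_four] at this
    linarith
  have hb₄ : p₄ 1 = 1 / 2 := by
    have := h₃₄ (by
      intro x
      fin_cases x <;> simp [upperProb_pr, Fin.sum_univ_four] <;> linarith) 0
    simp [upperProb_pr, Fin.sum_univ_four] at this
    linarith
  have hb₅ : p₅ 1 = 1 / 2 := by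
    have := h₅₄ (by
      intro x
      fin_cases x <;> simp [upperProb_pr, Fin.sum_univ_four] <;> linarith) 1
    simp [upperProb_pr, Fin.sum_univ_four] at this
    linarith
  funext x
  fin_cases x <;> simp <;> linarith
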